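/- arXiv:2511.15180 — 4 statements merged into one kernel-verified Lean document; each statement's English description precedes it below -/
import Mathlib

section
/- Let (h,u) be a C² smooth solution of the radially symmetric isentropic Euler equations in sound-speed form on an open set contained in {r > 0}, with h > 0 and c₁ c₂ ≠ 0 everywhere on that set. Then the gradient variable α satisfies the Riccati-type equation ∂₂ α = −((γ+1)/4) α² − ((3−γ)/4) α β + A₂ β − B₂ α, where A₂ = (m c₁/(2 r c₂²)) ((γ−1)/2 · u² − h²) and B₂ = (m/(r c₂²)) ( (γ−1)/4 · u³ + h³/2 + (γ−1)/4 · u² h + u h²/2 + (h u c₂/c₁)(h − ((γ−1)/2) u) ). -/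
open Real Set

/-- Partial derivative with respect to the spatial variable `r` (first coordinate). -/
noncomputable def pdr (f : ℝ × ℝ → ℝ) (p : ℝ × ℝ) : ℝ := fderiv ℝ f p (1, 0)

/-- Partial derivative with respect to the time variable `t` (second coordinate). -/
noncomputable def pdt (f : ℝ × ℝ → ℝ) (p : ℝ × ℝ) : ℝ := fderiv ℝ f p (0, 1)

/-- Directional derivative `∂_t + c ∂_r` along a characteristic with speed `c`. -/
noncomputable def Dc (c f : ℝ × ℝ → ℝ) (p : ℝ × ℝ) : ℝ := pdt f p + c p * pdr f p

/-- `(h,u)` solves the radially symmetric isentropic Euler equations in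
sound-speed form on the set `U`. -/
def IsEulerSound (γ : ℝ) (m : ℕ) (U : Set (ℝ × ℝ)) (h u : ℝ × ℝ → ℝ) : Prop :=
  ∀ p ∈ U,
    pdt h p + u p * pdr h p + (γ - 1) / 2 * h p * pdr u p
      = -((γ - 1) / 2) * ((m : ℝ) * u p * h p / p.1) ∧
    pdt u p + u p * pdr u p + 2 / (γ - 1) * h p * pdr h p = 0

/-- The gradient variable `α = u_r + (2/(γ-1)) h_r + m h u / (r c₂)`. -/
noncomputable def alp (γ : ℝ) (m : ℕ) (h u : ℝ × ℝ → ℝ) (p : ℝ × ℝ) : ℝ :=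
  pdr u p + 2 / (γ - 1) * pdr h p + (m : ℝ) * h p * u p / (p.1 * (u p + h p))

/-- The gradient variable `β = u_r - (2/(γ-1)) h_r - m h u / (r c₁)`. -/
noncomputable def bet (γ : ℝ) (m : ℕ) (h u : ℝ × ℝ → ℝ) (p : ℝ × ℝ) : ℝ :=
  pdr u p - 2 / (γ - 1) * pdr h p - (m : ℝ) * h p * u p / (p.1 * (u p - h p))

/-- The weighted gradient variable `α̃ = h^{(γ-3)/(2(γ-1))} α`. -/
noncomputable def alpT (γ : ℝ) (m : ℕ) (h u : ℝ × ℝ → ℝ) (p : ℝ × ℝ) : ℝ :=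
  h p ^ ((γ - 3) / (2 * (γ - 1))) * alp γ m h u p

/-- The weighted gradient variable `β̃ = h^{(γ-3)/(2(γ-1))} β`. -/
noncomputable def betT (γ : ℝ) (m : ℕ) (h u : ℝ × ℝ → ℝ) (p : ℝ × ℝ) : ℝ :=
  h p ^ ((γ - 3) / (2 * (γ - 1))) * bet γ m h u p

/-- The directional derivative of a differentiable function along a line. -/
lemma line_deriv_of_diff {f : ℝ × ℝ → ℝ} {p v : ℝ × ℝ} (hf : DifferentiableAt ℝ f p) :
    HasDerivAt (fun s : ℝ => f (p + s • v)) (fderiv ℝ f p v) 0 :=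
  hf.hasFDerivAt.hasLineDerivAt v

lemma fderiv_eq_of_line {f : ℝ × ℝ → ℝ} {p v : ℝ × ℝ} {d : ℝ} (hf : DifferentiableAt ℝ f p)
    (hd : HasDerivAt (fun s : ℝ => f (p + s • v)) d 0) : fderiv ℝ f p v = d :=
  (line_deriv_of_diff hf).unique hd

lemma diff_partial {f : ℝ × ℝ → ℝ} {p : ℝ × ℝ} (hf : ContDiffAt ℝ 2 f p) (v : ℝ × ℝ) :
    DifferentiableAt ℝ (fun q => fderiv ℝ f q v) p := by
  have h1 : DifferentiableAt ℝ (fderiv ℝ f) p :=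
    (hf.fderiv_right (m := 1) (by norm_num)).differentiableAt (by norm_num)
  exact h1.clm_apply (differentiableAt_const v)

lemma mixed_symm {f : ℝ × ℝ → ℝ} {p : ℝ × ℝ} (hf : ContDiffAt ℝ 2 f p) (v w : ℝ × ℝ) :
    fderiv ℝ (fun q => fderiv ℝ f q v) p w = fderiv ℝ (fun q => fderiv ℝ f q w) p v := by
  have h1 : DifferentiableAt ℝ (fderiv ℝ f) p :=
    (hf.fderiv_right (m := 1) (by norm_num)).differentiableAt (by norm_num)
  have hs : IsSymmSndFDerivAt ℝ f p := hf.isSymmSndFDerivAt (by simp)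
  have e : ∀ a b : ℝ × ℝ,
      fderiv ℝ (fun q => fderiv ℝ f q a) p b = fderiv ℝ (fderiv ℝ f) p b a := by
    intro a b
    rw [fderiv_clm_apply h1 (differentiableAt_const a)]
    simp
  rw [e, e]
  exact hs w v

lemma alp_deriv (γ : ℝ) (m : ℕ) {h u : ℝ × ℝ → ℝ} {p : ℝ × ℝ}
    (hh : ContDiffAt ℝ 2 h p) (hu : ContDiffAt ℝ 2 u p) (hr : p.1 ≠ 0)
    (hc : u p + h p ≠ 0) (v : ℝ × ℝ) :
    fderiv ℝ (alp γ m h u) p v =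
      fderiv ℝ (pdr u) p v + 2 / (γ - 1) * fderiv ℝ (pdr h) p v
      + (m * (fderiv ℝ h p v * u p + h p * fderiv ℝ u p v) / (p.1 * (u p + h p))
        - m * h p * u p * (v.1 * (u p + h p) + p.1 * (fderiv ℝ u p v + fderiv ℝ h p v))
          / (p.1 * (u p + h p)) ^ 2) := by
  have dh : DifferentiableAt ℝ h p := hh.differentiableAt (by norm_num)
  have du : DifferentiableAt ℝ u p := hu.differentiableAt (by norm_num)
  have dhr : DifferentiableAt ℝ (pdr h) p := diff_partial hh (1, 0)
  have dur : DifferentiableAt ℝ (pdr u) p := diff_partial hu (1, 0)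
  have hne : p.1 * (u p + h p) ≠ 0 := mul_ne_zero hr hc
  apply fderiv_eq_of_line
  · unfold alp
    fun_prop (disch := assumption)
  · have lr := line_deriv_of_diff (v := v) (differentiableAt_fst (𝕜 := ℝ) (p := p))
    have lh := line_deriv_of_diff (v := v) dh
    have lu := line_deriv_of_diff (v := v) du
    have lhr := line_deriv_of_diff (v := v) dhr
    have lur := line_deriv_of_diff (v := v) dur
    have := (lur.add (lhr.const_mul (2 / (γ - 1)))).add
      (((lh.const_mul (m : ℝ)).mul lu).div (lr.mul (lu.add lh)) (by simpa using hne))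
    refine this.congr_deriv ?_
    simp [fderiv_fst]
    field_simp

lemma euler_pdt_h {γ : ℝ} {m : ℕ} {U : Set (ℝ × ℝ)} (hU : IsOpen U) {h u : ℝ × ℝ → ℝ}
    (heuler : IsEulerSound γ m U h u) {p : ℝ × ℝ} (hp : p ∈ U)
    (hh : ContDiffAt ℝ 2 h p) (hu : ContDiffAt ℝ 2 u p) (hr : p.1 ≠ 0) :
    pdt (pdr h) p = -(pdr u p * pdr h p + u p * pdr (pdr h) p)
      - (γ - 1) / 2 * (pdr h p * pdr u p + h p * pdr (pdr u) p)
      - (γ - 1) / 2 * m * ((pdr u p * h p + u p * pdr h p) / p.1 - u p * h p / p.1 ^ 2) := by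
  have dh : DifferentiableAt ℝ h p := hh.differentiableAt (by norm_num)
  have du : DifferentiableAt ℝ u p := hu.differentiableAt (by norm_num)
  have dhr : DifferentiableAt ℝ (pdr h) p := diff_partial hh (1, 0)
  have dur : DifferentiableAt ℝ (pdr u) p := diff_partial hu (1, 0)
  have s : pdt (pdr h) p = pdr (pdt h) p := mixed_symm hh (1, 0) (0, 1)
  have ev : pdt h =ᶠ[nhds p] fun q => -((γ - 1) / 2) * ((m : ℝ) * u q * h q / q.1)
      - u q * pdr h q - (γ - 1) / 2 * h q * pdr u q := by
    filter_upwards [hU.mem_nhds hp] with q hq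
    linarith [(heuler q hq).1]
  rw [s, pdr, ev.fderiv_eq]
  apply fderiv_eq_of_line
  · fun_prop (disch := assumption)
  · have lr := line_deriv_of_diff (v := (1, 0)) (differentiableAt_fst (𝕜 := ℝ) (p := p))
    have lh := line_deriv_of_diff (v := (1, 0)) dh
    have lu := line_deriv_of_diff (v := (1, 0)) du
    have lhr := line_deriv_of_diff (v := (1, 0)) dhr
    have lur := line_deriv_of_diff (v := (1, 0)) dur
    have := (((((lu.const_mul (m : ℝ)).mul lh).div lr (by simpa using hr)).const_mul
      (-((γ - 1) / 2))).sub (lu.mul lhr)).sub ((lh.const_mul ((γ - 1) / 2)).mul lur)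
    refine this.congr_deriv ?_
    have hz : p + ((0 : ℝ), (0 : ℝ)) = p := add_zero p
    simp [fderiv_fst, hz]
    simp only [← pdr.eq_1]
    field_simp
    ring

lemma euler_pdt_u {γ : ℝ} {m : ℕ} {U : Set (ℝ × ℝ)} (hU : IsOpen U) {h u : ℝ × ℝ → ℝ}
    (heuler : IsEulerSound γ m U h u) {p : ℝ × ℝ} (hp : p ∈ U)
    (hh : ContDiffAt ℝ 2 h p) (hu : ContDiffAt ℝ 2 u p) :
    pdt (pdr u) p = -(pdr u p * pdr u p + u p * pdr (pdr u) p)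
      - 2 / (γ - 1) * (pdr h p * pdr h p + h p * pdr (pdr h) p) := by
  have dh : DifferentiableAt ℝ h p := hh.differentiableAt (by norm_num)
  have du : DifferentiableAt ℝ u p := hu.differentiableAt (by norm_num)
  have dhr : DifferentiableAt ℝ (pdr h) p := diff_partial hh (1, 0)
  have dur : DifferentiableAt ℝ (pdr u) p := diff_partial hu (1, 0)
  have s : pdt (pdr u) p = pdr (pdt u) p := mixed_symm hu (1, 0) (0, 1)
  have ev : pdt u =ᶠ[nhds p] fun q =>
      -(u q * pdr u q) - 2 / (γ - 1) * h q * pdr h q := by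
    filter_upwards [hU.mem_nhds hp] with q hq
    linarith [(heuler q hq).2]
  rw [s, pdr, ev.fderiv_eq]
  apply fderiv_eq_of_line
  · fun_prop
  · have lh := line_deriv_of_diff (v := (1, 0)) dh
    have lu := line_deriv_of_diff (v := (1, 0)) du
    have lhr := line_deriv_of_diff (v := (1, 0)) dhr
    have lur := line_deriv_of_diff (v := (1, 0)) dur
    have := (lu.mul lur).neg.sub ((lh.const_mul (2 / (γ - 1))).mul lhr)
    refine this.congr_deriv ?_
    simp
    simp only [← pdr.eq_1]
    ring

/-- Riccati-type equation `∂₂α = -((γ+1)/4)α² - ((3-γ)/4)αβ + A₂β - B₂α`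
for a `C²` smooth solution of the sound-speed Euler system with `h > 0` and
`c₁c₂ ≠ 0` on an open set contained in `{r > 0}`. -/
theorem riccati_alpha
    (γ : ℝ) (hγ : 1 < γ) (m : ℕ) (hm : 1 ≤ m)
    (U : Set (ℝ × ℝ)) (hU : IsOpen U) (hUr : ∀ p ∈ U, 0 < p.1)
    (h u : ℝ × ℝ → ℝ) (hhpos : ∀ p ∈ U, 0 < h p)
    (hc : ∀ p ∈ U, (u p - h p) * (u p + h p) ≠ 0)
    (hhC : ContDiffOn ℝ 2 h U) (huC : ContDiffOn ℝ 2 u U)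
    (heuler : IsEulerSound γ m U h u) :
    ∀ p ∈ U,
      Dc (fun q => u q + h q) (alp γ m h u) p
        = -((γ + 1) / 4) * alp γ m h u p ^ 2
          - (3 - γ) / 4 * (alp γ m h u p * bet γ m h u p)
          + ((m : ℝ) * (u p - h p) / (2 * p.1 * (u p + h p) ^ 2)
              * ((γ - 1) / 2 * u p ^ 2 - h p ^ 2)) * bet γ m h u p
          - ((m : ℝ) / (p.1 * (u p + h p) ^ 2)
              * ((γ - 1) / 4 * u p ^ 3 + 1 / 2 * h p ^ 3
                + (γ - 1) / 4 * u p ^ 2 * h p + 1 / 2 * u p * h p ^ 2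
                + h p * u p * (u p + h p) / (u p - h p)
                  * (h p - (γ - 1) / 2 * u p))) * alp γ m h u p := by
  intro p hp
  have hh := hhC.contDiffAt (hU.mem_nhds hp)
  have hu := huC.contDiffAt (hU.mem_nhds hp)
  have hr : p.1 ≠ 0 := (hUr p hp).ne'
  have h1 : u p - h p ≠ 0 := left_ne_zero_of_mul (hc p hp)
  have h2 : u p + h p ≠ 0 := right_ne_zero_of_mul (hc p hp)
  have hg : γ - 1 ≠ 0 := by linarith
  have ar := alp_deriv γ m hh hu hr h2 (1, 0)
  have at' := alp_deriv γ m hh hu hr h2 (0, 1)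
  have eh := euler_pdt_h hU heuler hp hh hu hr
  have eu := euler_pdt_u hU heuler hp hh hu
  simp only [← pdr.eq_1, ← pdt.eq_1] at ar at'
  have e1 : pdt h p = -((γ - 1) / 2) * ((m : ℝ) * u p * h p / p.1)
      - u p * pdr h p - (γ - 1) / 2 * h p * pdr u p := by linarith [(heuler p hp).1]
  have e2 : pdt u p = -(u p * pdr u p) - 2 / (γ - 1) * h p * pdr h p := by
    linarith [(heuler p hp).2]
  rw [eh, eu, e1, e2] at at'
  rw [Dc, ar, at', alp, bet]
  generalize pdr (pdr h) p = A
  generalize pdr (pdr u) p = B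
  generalize pdr h p = a
  generalize pdr u p = b
  generalize h p = x at *
  generalize u p = y at *
  generalize p.1 = r at *
  generalize (m : ℝ) = M
  clear ar at' eh eu e1 e2
  obtain ⟨g, rfl⟩ : ∃ g, γ = g + 1 := ⟨γ - 1, by ring⟩
  simp only [add_sub_cancel_right] at hg ⊢
  obtain ⟨c, rfl⟩ : ∃ c, x = c - y := ⟨x + y, by ring⟩
  simp only [add_sub_cancel] at h2 ⊢
  field_simp
  ring
end

section
/- Let (h,u) be a C² smooth solution of the radially symmetric isentropic Euler equations in sound-speed form on an open set contained in {r > 0}, with h > 0 and c₁ c₂ ≠ 0 everywhere on that set. Then the weighted gradient variable β̃ satisfies ∂₁ β̃ = −((γ+1)/4) h^{−(γ−3)/(2(γ−1))} β̃² + (m c₂/(2 r c₁²)) ((γ−1)/2 · u² − h²) α̃ − ( m [ (γ−3) u² + (u+h)² ] / (2 r c₁) ) β̃. -/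
open Real Set

theorem aux_line (f : ℝ × ℝ → ℝ) (p v : ℝ × ℝ) (hf : DifferentiableAt ℝ f p) :
    HasDerivAt (fun s : ℝ => f (p + s • v)) (fderiv ℝ f p v) 0 := by
  have h1 : HasFDerivAt f (fderiv ℝ f p) (p + (0 : ℝ) • v) := by simpa using hf.hasFDerivAt
  have h2 : HasDerivAt (fun s : ℝ => p + s • v) v 0 := by
    simpa using ((hasDerivAt_id (0 : ℝ)).smul_const v).const_add p
  exact h1.comp_hasDerivAt 0 h2

theorem aux_lin (L : ℝ × ℝ →L[ℝ] ℝ) (c : ℝ) : L (c, 1) = L (0, 1) + c * L (1, 0) := by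
  have : ((c, 1) : ℝ × ℝ) = (0, 1) + c • (1, 0) := by simp
  rw [this, map_add, map_smul, smul_eq_mul]

theorem aux_second (f : ℝ × ℝ → ℝ) (p : ℝ × ℝ) (hf : ContDiffAt ℝ 2 f p) :
    DifferentiableAt ℝ f p ∧ DifferentiableAt ℝ (pdr f) p ∧ DifferentiableAt ℝ (pdt f) p ∧
      pdt (pdr f) p = pdr (pdt f) p := by
  have hd : DifferentiableAt ℝ (fderiv ℝ f) p :=
    (hf.fderiv_right (m := 1) (by norm_num)).differentiableAt (by norm_num)
  have h1 : ∀ v : ℝ × ℝ, HasFDerivAt (fun q => fderiv ℝ f q v)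
      ((ContinuousLinearMap.apply ℝ ℝ v).comp (fderiv ℝ (fderiv ℝ f) p)) p := fun v =>
    (ContinuousLinearMap.apply ℝ ℝ v).hasFDerivAt.comp p hd.hasFDerivAt
  refine ⟨hf.differentiableAt (by norm_num), (h1 (1, 0)).differentiableAt,
    (h1 (0, 1)).differentiableAt, ?_⟩
  have hs : IsSymmSndFDerivAt ℝ f p := hf.isSymmSndFDerivAt (by simp)
  have e1 : fderiv ℝ (pdr f) p = _ := (h1 (1, 0)).fderiv
  have e2 : fderiv ℝ (pdt f) p = _ := (h1 (0, 1)).fderiv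
  rw [pdt, e1, pdr, e2]
  exact hs.eq _ _

/-- the weighted gradient variable `β̃ = h^{(γ-3)/(2(γ-1))} β` satisfies
`∂₁β̃ = -((γ+1)/4) h^{-(γ-3)/(2(γ-1))} β̃² + (mc₂/(2rc₁²))((γ-1)/2·u² - h²) α̃
  - (m[(γ-3)u² + (u+h)²]/(2rc₁)) β̃` for a `C²` smooth solution. -/
theorem weighted_riccati_beta
    (γ : ℝ) (hγ : 1 < γ) (m : ℕ) (hm : 1 ≤ m)
    (U : Set (ℝ × ℝ)) (hU : IsOpen U) (hUr : ∀ p ∈ U, 0 < p.1)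
    (h u : ℝ × ℝ → ℝ) (hhpos : ∀ p ∈ U, 0 < h p)
    (hc : ∀ p ∈ U, (u p - h p) * (u p + h p) ≠ 0)
    (hhC : ContDiffOn ℝ 2 h U) (huC : ContDiffOn ℝ 2 u U)
    (heuler : IsEulerSound γ m U h u) :
    ∀ p ∈ U,
      Dc (fun q => u q - h q) (betT γ m h u) p
        = -((γ + 1) / 4) * h p ^ (-(γ - 3) / (2 * (γ - 1))) * betT γ m h u p ^ 2
          + (m : ℝ) * (u p + h p) / (2 * p.1 * (u p - h p) ^ 2)
              * ((γ - 1) / 2 * u p ^ 2 - h p ^ 2) * alpT γ m h u p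
          - (m : ℝ) * ((γ - 3) * u p ^ 2 + (u p + h p) ^ 2)
              / (2 * p.1 * (u p - h p)) * betT γ m h u p := by
  intro p hp
  have hnh : ∀ q ∈ U, ContDiffAt ℝ 2 h q := fun q hq => hhC.contDiffAt (hU.mem_nhds hq)
  have hnu : ∀ q ∈ U, ContDiffAt ℝ 2 u q := fun q hq => huC.contDiffAt (hU.mem_nhds hq)
  obtain ⟨dh, dhr, dht, sh⟩ := aux_second h p (hnh p hp)
  obtain ⟨du, dur, dut, su⟩ := aux_second u p (hnu p hp)
  have hr := hUr p hp
  have hh := hhpos p hp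
  have hc1 : u p - h p ≠ 0 := left_ne_zero_of_mul (hc p hp)
  have hc2 : u p + h p ≠ 0 := right_ne_zero_of_mul (hc p hp)
  have hg : γ - 1 ≠ 0 := by linarith
  -- the line in direction v stays in U
  have hev : ∀ v : ℝ × ℝ, ∀ᶠ s : ℝ in nhds 0, p + s • v ∈ U := by
    intro v
    have : ContinuousAt (fun s : ℝ => p + s • v) 0 := by fun_prop
    exact this.eventually_mem (by simpa using hU.mem_nhds hp)
  have dfst : ∀ v : ℝ × ℝ, HasDerivAt (fun s : ℝ => (p + s • v).1) v.1 0 := by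
    intro v
    have := aux_line (fun q => q.1) p v differentiableAt_fst
    have e : fderiv ℝ (fun q : ℝ × ℝ => q.1) p = ContinuousLinearMap.fst ℝ ℝ ℝ := fderiv_fst
    rw [e] at this
    exact this
  obtain ⟨E1, E2⟩ := heuler p hp
  -- r-derivative of the Euler equations
  have F1 : pdr (pdt h) p + (pdr u p * pdr h p + u p * pdr (pdr h) p)
      + (γ - 1) / 2 * (pdr h p * pdr u p + h p * pdr (pdr u) p)
      = -((γ - 1) / 2) * (m * ((pdr u p * h p + u p * pdr h p) * p.1 - u p * h p) / p.1 ^ 2) := by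
    have L := ((aux_line _ p (1, 0) dht).add ((aux_line _ p (1, 0) du).mul
      (aux_line _ p (1, 0) dhr))).add
      (((aux_line _ p (1, 0) dh).mul (aux_line _ p (1, 0) dur)).const_mul ((γ - 1) / 2))
    have R := ((((aux_line _ p (1, 0) du).mul (aux_line _ p (1, 0) dh)).const_mul (m : ℝ)).div
      (dfst (1, 0)) (by simpa using hr.ne')).const_mul (-((γ - 1) / 2))
    have := L.unique (R.congr_of_eventuallyEq (by
      filter_upwards [hev (1, 0)] with s hs
      have := (heuler _ hs).1
      simp only [Pi.add_apply, Pi.mul_apply, Pi.div_apply]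
      linear_combination this))
    simp only [zero_smul, add_zero, Pi.mul_apply] at this
    simp only [pdr] at this ⊢
    linear_combination this
  have F2 : pdr (pdt u) p + (pdr u p * pdr u p + u p * pdr (pdr u) p)
      + 2 / (γ - 1) * (pdr h p * pdr h p + h p * pdr (pdr h) p) = 0 := by
    have L := ((aux_line _ p (1, 0) dut).add ((aux_line _ p (1, 0) du).mul
      (aux_line _ p (1, 0) dur))).add
      (((aux_line _ p (1, 0) dh).mul (aux_line _ p (1, 0) dhr)).const_mul (2 / (γ - 1)))
    have := L.unique ((hasDerivAt_const (0 : ℝ) (0 : ℝ)).congr_of_eventuallyEq (by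
      filter_upwards [hev (1, 0)] with s hs
      have := (heuler _ hs).2
      simp only [Pi.add_apply, Pi.mul_apply]
      linear_combination this))
    simp only [zero_smul, add_zero] at this
    simp only [pdr] at this ⊢
    linear_combination this
  -- derivative of the weighted variable
  have dfst' : DifferentiableAt ℝ (fun q : ℝ × ℝ => q.1) p := differentiableAt_fst
  have dB : DifferentiableAt ℝ (betT γ m h u) p := by
    unfold betT bet
    refine (dh.rpow_const (Or.inl hh.ne')).mul ?_
    have d3 : DifferentiableAt ℝ (fun q : ℝ × ℝ => q.1 * (u q - h q)) p := dfst'.mul (du.sub dh)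
    have d4 : DifferentiableAt ℝ (fun q : ℝ × ℝ => (m : ℝ) * h q * u q) p :=
      (dh.const_mul _).mul du
    have hne : (fun q : ℝ × ℝ => q.1 * (u q - h q)) p ≠ 0 := mul_ne_zero hr.ne' hc1
    simp only [div_eq_mul_inv]
    exact (dur.sub (dhr.const_mul _)).sub (d4.mul (d3.inv hne))
  set c : ℝ := u p - h p with hcdef
  set k : ℝ := (γ - 3) / (2 * (γ - 1)) with hk
  have T1 := aux_line _ p (c, 1) dB
  have A1 := aux_line _ p (c, 1) dh
  have A2 := aux_line _ p (c, 1) du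
  have A3 := aux_line _ p (c, 1) dhr
  have A4 := aux_line _ p (c, 1) dur
  have T2 := (A1.rpow_const (p := k) (Or.inl (by simpa using hh.ne'))).mul
    ((A4.sub (A3.const_mul (2 / (γ - 1)))).sub
      (((A1.const_mul (m : ℝ)).mul A2).div ((dfst (c, 1)).mul (A2.sub A1))
        (by
          simp only [Pi.mul_apply, Pi.sub_apply, zero_smul, add_zero]
          exact mul_ne_zero hr.ne' hc1)))
  have T := T1.unique T2
  have hD : Dc (fun q => u q - h q) (betT γ m h u) p = fderiv ℝ (betT γ m h u) p (c, 1) := by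
    rw [aux_lin]; rfl
  have hpow1 : h p ^ (k - 1) = h p ^ k / h p := by rw [Real.rpow_sub_one hh.ne']
  have hpow2 : h p ^ (-(γ - 3) / (2 * (γ - 1))) = (h p ^ k)⁻¹ := by
    rw [neg_div, Real.rpow_neg hh.le]
  have hX : h p ^ k ≠ 0 := (Real.rpow_pos_of_pos hh k).ne'
  rw [hD, T, hpow2]
  have e1 : fderiv ℝ h p (c, 1) = pdt h p + c * pdr h p := aux_lin _ _
  have e2 : fderiv ℝ u p (c, 1) = pdt u p + c * pdr u p := aux_lin _ _
  have e3 : fderiv ℝ (pdr h) p (c, 1) = pdt (pdr h) p + c * pdr (pdr h) p := aux_lin _ _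
  have e4 : fderiv ℝ (pdr u) p (c, 1) = pdt (pdr u) p + c * pdr (pdr u) p := aux_lin _ _
  simp only [e1, e2, e3, e4, zero_smul, add_zero, Pi.mul_apply, Pi.sub_apply, Pi.div_apply, hpow1,
    sh, su, betT, alpT, bet, alp, ← hk, ← hcdef]
  have G1 := eq_sub_of_add_eq (eq_sub_of_add_eq E1)
  have G2 := eq_sub_of_add_eq (eq_sub_of_add_eq E2)
  have G3 := eq_sub_of_add_eq (eq_sub_of_add_eq F1)
  have G4 := eq_sub_of_add_eq (eq_sub_of_add_eq F2)
  rw [G1, G2, G3, G4, hk]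
  clear_value c
  clear G1 G2 G3 G4 E1 E2 F1 F2 T T1 T2 A1 A2 A3 A4 e1 e2 e3 e4 hD hpow1 hpow2
  generalize h p ^ k = X at *
  generalize pdr (pdr h) p = hrr
  generalize pdr (pdr u) p = urr
  generalize pdr h p = hr'
  generalize pdr u p = ur
  generalize p.1 = r at *
  generalize h p = H at *
  have hu : u p = c + H := by linarith
  rw [hu] at hc2 ⊢
  generalize (m : ℝ) = M
  have hr0 := hr.ne'
  have hh0 := hh.ne'
  obtain ⟨a, rfl⟩ : ∃ a, γ = a + 1 := ⟨γ - 1, by ring⟩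
  have ha : a ≠ 0 := by simpa using hg
  simp only [add_sub_cancel_right]
  field_simp
  ring
end

section
/- Let (h,u) be a C² smooth solution of the radially symmetric isentropic Euler equations in sound-speed form on an open set contained in {r > 0}, with h > 0 and c₁ c₂ ≠ 0 everywhere on that set. Then the weighted gradient variable α̃ satisfies ∂₂ α̃ = −((γ+1)/4) h^{−(γ−3)/(2(γ−1))} α̃² + (m c₁/(2 r c₂²)) ((γ−1)/2 · u² − h²) β̃ − ( m [ (γ−3) u² + (u−h)² ] / (2 r c₂) ) α̃. -/
open Real Set

/-- A second-order package: value, first and second derivatives of a `C²` function. -/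
lemma wra_pack (f : ℝ × ℝ → ℝ) (p : ℝ × ℝ) (hf : ContDiffAt ℝ 2 f p) :
    HasFDerivAt f (fderiv ℝ f p) p ∧
    HasFDerivAt (pdr f) (fderiv ℝ (pdr f) p) p ∧
    HasFDerivAt (pdt f) (fderiv ℝ (pdt f) p) p ∧
    fderiv ℝ (pdt f) p (1, 0) = fderiv ℝ (pdr f) p (0, 1) := by
  have h1 : DifferentiableAt ℝ f p := hf.differentiableAt (by norm_num)
  have h2 : DifferentiableAt ℝ (fderiv ℝ f) p :=
    (hf.fderiv_right (m := 1) (by norm_num)).differentiableAt (by norm_num)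
  have key : ∀ v : ℝ × ℝ, HasFDerivAt (fun q => fderiv ℝ f q v)
      ((fderiv ℝ (fderiv ℝ f) p).flip v) p := by
    intro v
    have := h2.hasFDerivAt.clm_apply (hasFDerivAt_const v p)
    have e : (fderiv ℝ (fderiv ℝ f) p).flip v
        = (fderiv ℝ f p).comp (0 : ℝ × ℝ →L[ℝ] ℝ × ℝ) + (fderiv ℝ (fderiv ℝ f) p).flip v := by
      rw [ContinuousLinearMap.comp_zero, zero_add]
    rw [e]
    exact this
  have hr : HasFDerivAt (pdr f) ((fderiv ℝ (fderiv ℝ f) p).flip (1, 0)) p := key (1, 0)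
  have ht : HasFDerivAt (pdt f) ((fderiv ℝ (fderiv ℝ f) p).flip (0, 1)) p := key (0, 1)
  refine ⟨h1.hasFDerivAt, hr.differentiableAt.hasFDerivAt, ht.differentiableAt.hasFDerivAt, ?_⟩
  rw [hr.fderiv, ht.fderiv]
  have sy : IsSymmSndFDerivAt ℝ f p := hf.isSymmSndFDerivAt (by simp)
  simpa using sy.eq (1, 0) (0, 1)

/-- The pointwise algebraic identity. -/
lemma wra_alg (g m r h u ht hr ut ur htr hrr utr urr : ℝ) (hg : g - 1 ≠ 0) (r0 : r ≠ 0)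
    (h0 : h ≠ 0) (c10 : u - h ≠ 0) (c20 : u + h ≠ 0)
    (e1 : ht + u * hr + (g - 1) / 2 * h * ur = -((g - 1) / 2) * (m * u * h / r))
    (e2 : ut + u * ur + 2 / (g - 1) * h * hr = 0)
    (d1 : htr + (ur * hr + u * hrr) + (g - 1) / 2 * (hr * ur + h * urr)
      = -((g - 1) / 2) * (m * (ur * h + u * hr) / r - m * u * h / r ^ 2))
    (d2 : utr + (ur * ur + u * urr) + 2 / (g - 1) * (hr * hr + h * hrr) = 0) :
    (g - 3) / (2 * (g - 1)) / h * (ht + (u + h) * hr)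
        * (ur + 2 / (g - 1) * hr + m * h * u / (r * (u + h)))
      + (utr + 2 / (g - 1) * htr + (m * (ht * u + h * ut) / (r * (u + h))
          - m * h * u * (r * (ut + ht)) / (r * (u + h)) ^ 2)
        + (u + h) * (urr + 2 / (g - 1) * hrr + (m * (hr * u + h * ur) / (r * (u + h))
          - m * h * u * ((u + h) + r * (ur + hr)) / (r * (u + h)) ^ 2)))
    = -((g + 1) / 4) * (ur + 2 / (g - 1) * hr + m * h * u / (r * (u + h))) ^ 2
      + m * (u - h) / (2 * r * (u + h) ^ 2) * ((g - 1) / 2 * u ^ 2 - h ^ 2)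
        * (ur - 2 / (g - 1) * hr - m * h * u / (r * (u - h)))
      - m * ((g - 3) * u ^ 2 + (u - h) ^ 2) / (2 * r * (u + h))
        * (ur + 2 / (g - 1) * hr + m * h * u / (r * (u + h))) := by
  have e1' : ht = -((g - 1) / 2) * (m * u * h / r) - u * hr - (g - 1) / 2 * h * ur := by linarith
  have e2' : ut = - u * ur - 2 / (g - 1) * h * hr := by linarith
  have d1' : htr = -((g - 1) / 2) * (m * (ur * h + u * hr) / r - m * u * h / r ^ 2)
    - (ur * hr + u * hrr) - (g - 1) / 2 * (hr * ur + h * urr) := by linarith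
  have d2' : utr = - (ur * ur + u * urr) - 2 / (g - 1) * (hr * hr + h * hrr) := by linarith
  subst e1' e2' d1' d2'
  field_simp
  ring

/-- the weighted gradient variable `α̃ = h^{(γ-3)/(2(γ-1))} α` satisfies
`∂₂α̃ = -((γ+1)/4) h^{-(γ-3)/(2(γ-1))} α̃² + (mc₁/(2rc₂²))((γ-1)/2·u² - h²) β̃
  - (m[(γ-3)u² + (u-h)²]/(2rc₂)) α̃` for a `C²` smooth solution. -/
theorem weighted_riccati_alpha
    (γ : ℝ) (hγ : 1 < γ) (m : ℕ) (hm : 1 ≤ m)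
    (U : Set (ℝ × ℝ)) (hU : IsOpen U) (hUr : ∀ p ∈ U, 0 < p.1)
    (h u : ℝ × ℝ → ℝ) (hhpos : ∀ p ∈ U, 0 < h p)
    (hc : ∀ p ∈ U, (u p - h p) * (u p + h p) ≠ 0)
    (hhC : ContDiffOn ℝ 2 h U) (huC : ContDiffOn ℝ 2 u U)
    (heuler : IsEulerSound γ m U h u) :
    ∀ p ∈ U,
      Dc (fun q => u q + h q) (alpT γ m h u) p
        = -((γ + 1) / 4) * h p ^ (-(γ - 3) / (2 * (γ - 1))) * alpT γ m h u p ^ 2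
          + (m : ℝ) * (u p - h p) / (2 * p.1 * (u p + h p) ^ 2)
              * ((γ - 1) / 2 * u p ^ 2 - h p ^ 2) * betT γ m h u p
          - (m : ℝ) * ((γ - 3) * u p ^ 2 + (u p - h p) ^ 2)
              / (2 * p.1 * (u p + h p)) * alpT γ m h u p := by
  intro p hp
  have hn : U ∈ nhds p := hU.mem_nhds hp
  obtain ⟨Hh, Hhr, Hht, Sh⟩ := wra_pack h p (hhC.contDiffAt hn)
  obtain ⟨Hu, Hur, Hut, Su⟩ := wra_pack u p (huC.contDiffAt hn)
  have r0 : p.1 ≠ 0 := (hUr p hp).ne'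
  have hpos := hhpos p hp
  have h0 : h p ≠ 0 := hpos.ne'
  have c10 : u p - h p ≠ 0 := left_ne_zero_of_mul (hc p hp)
  have c20 : u p + h p ≠ 0 := right_ne_zero_of_mul (hc p hp)
  have hg : γ - 1 ≠ 0 := by linarith
  have Hr : HasFDerivAt (fun q : ℝ × ℝ => q.1) (ContinuousLinearMap.fst ℝ ℝ ℝ) p :=
    hasFDerivAt_fst
  obtain ⟨e1, e2⟩ := heuler p hp
  -- differentiate the first equation in r
  have d1 : pdr (pdt h) p + (pdr u p * pdr h p + u p * pdr (pdr h) p)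
      + (γ - 1) / 2 * (pdr h p * pdr u p + h p * pdr (pdr u) p)
      = -((γ - 1) / 2) * ((m : ℝ) * (pdr u p * h p + u p * pdr h p) / p.1
        - (m : ℝ) * u p * h p / p.1 ^ 2) := by
    have L := (Hht.add (Hu.mul Hhr)).add ((Hh.const_mul ((γ - 1) / 2)).mul Hur)
    have R := (((Hu.const_mul (m : ℝ)).mul Hh).mul
      ((hasDerivAt_inv r0).comp_hasFDerivAt p Hr)).const_mul (-((γ - 1) / 2))
    have E := L.congr_of_eventuallyEq (f₁ := fun q => -((γ - 1) / 2) *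
      ((m : ℝ) * u q * h q * (q.1)⁻¹)) (by
        filter_upwards [hn] with q hq
        have := (heuler q hq).1
        simp only [div_eq_mul_inv] at this ⊢
        exact this.symm)
    have Q := congrArg (fun T : ℝ × ℝ →L[ℝ] ℝ => T (1, 0)) (E.unique R)
    simp at Q
    simp only [pdr] at Q ⊢
    linear_combination (exp := 1) Q
  have d2 : pdr (pdt u) p + (pdr u p * pdr u p + u p * pdr (pdr u) p)
      + 2 / (γ - 1) * (pdr h p * pdr h p + h p * pdr (pdr h) p) = 0 := by
    have L := (Hut.add (Hu.mul Hur)).add ((Hh.const_mul (2 / (γ - 1))).mul Hhr)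
    have E := L.congr_of_eventuallyEq (f₁ := fun q => (0 : ℝ)) (by
        filter_upwards [hn] with q hq
        exact ((heuler q hq).2).symm)
    have Q := congrArg (fun T : ℝ × ℝ →L[ℝ] ℝ => T (1, 0)) (E.unique (hasFDerivAt_const 0 p))
    simp at Q
    simp only [pdr] at Q ⊢
    linear_combination (exp := 1) Q
  have Halp := (Hur.add (Hhr.const_mul (2 / (γ - 1)))).add
    (((Hh.const_mul (m : ℝ)).mul Hu).mul
      ((hasDerivAt_inv (mul_ne_zero r0 c20)).comp_hasFDerivAt p (Hr.mul (Hu.add Hh))))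
  have HT := (Hh.rpow_const (p := (γ - 3) / (2 * (γ - 1))) (Or.inl h0)).mul Halp
  have HT' : HasFDerivAt (alpT γ m h u) _ p := HT
  have Sh' : pdr (pdt h) p = pdt (pdr h) p := Sh
  have Su' : pdr (pdt u) p = pdt (pdr u) p := Su
  rw [Sh'] at d1
  rw [Su'] at d2
  have A := wra_alg γ m p.1 (h p) (u p) (pdt h p) (pdr h p) (pdt u p) (pdr u p)
    (pdt (pdr h) p) (pdr (pdr h) p) (pdt (pdr u) p) (pdr (pdr u) p) hg r0 h0 c10 c20 e1 e2 d1 d2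
  have hk : h p ^ (-(γ - 3) / (2 * (γ - 1))) * h p ^ ((γ - 3) / (2 * (γ - 1))) = 1 := by
    rw [← Real.rpow_add hpos, neg_div, neg_add_cancel, Real.rpow_zero]
  have hk1 : h p ^ ((γ - 3) / (2 * (γ - 1)) - 1) = h p ^ ((γ - 3) / (2 * (γ - 1))) / h p :=
    Real.rpow_sub_one h0 _
  have Dr : pdr (alpT γ m h u) p = h p ^ ((γ - 3) / (2 * (γ - 1))) *
      ((γ - 3) / (2 * (γ - 1)) / h p * pdr h p * alp γ m h u p
        + (pdr (pdr u) p + 2 / (γ - 1) * pdr (pdr h) p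
        + ((m : ℝ) * (pdr h p * u p + h p * pdr u p) / (p.1 * (u p + h p))
          - (m : ℝ) * h p * u p * ((u p + h p) + p.1 * (pdr u p + pdr h p))
            / (p.1 * (u p + h p)) ^ 2))) := by
    rw [pdr, HT'.fderiv]
    simp [hk1]
    simp only [pdr, alp, div_eq_mul_inv, mul_inv]
    ring
  have Dt : pdt (alpT γ m h u) p = h p ^ ((γ - 3) / (2 * (γ - 1))) *
      ((γ - 3) / (2 * (γ - 1)) / h p * pdt h p * alp γ m h u p
        + (pdt (pdr u) p + 2 / (γ - 1) * pdt (pdr h) p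
        + ((m : ℝ) * (pdt h p * u p + h p * pdt u p) / (p.1 * (u p + h p))
          - (m : ℝ) * h p * u p * (p.1 * (pdt u p + pdt h p))
            / (p.1 * (u p + h p)) ^ 2))) := by
    rw [pdt, HT'.fderiv]
    simp [hk1]
    simp only [pdr, pdt, alp, div_eq_mul_inv, mul_inv]
    ring
  rw [Dc, Dr, Dt]
  simp only [alpT, betT]
  have B : alp γ m h u p = pdr u p + 2 / (γ - 1) * pdr h p
    + (m : ℝ) * h p * u p / (p.1 * (u p + h p)) := rfl
  have C : bet γ m h u p = pdr u p - 2 / (γ - 1) * pdr h p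
    - (m : ℝ) * h p * u p / (p.1 * (u p - h p)) := rfl
  rw [← B, ← C] at A
  generalize h p ^ ((γ - 3) / (2 * (γ - 1))) = K at *
  generalize h p ^ (-(γ - 3) / (2 * (γ - 1))) = K' at *
  linear_combination K * A + (γ + 1) / 4 * K * alp γ m h u p ^ 2 * hk
end

section
/- Let (h,u) be a C¹ smooth solution of the radially symmetric isentropic Euler equations in sound-speed form on an open set contained in {r > 0}, with h > 0 and c₁ c₂ ≠ 0 everywhere on that set. Then at every point, ∂₁ c₂ = −((γ+1)/2) h^{(γ+1)/(2(γ−1))} ( α̃ + ( m u [ (γ−1) u − 2 h ] / ((γ+1) r c₂) ) h^{(γ−3)/(2(γ−1))} ). -/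
open Real Set

/-- for a `C¹` smooth solution with `h > 0` and `c₁c₂ ≠ 0`,
`∂₁c₂ = -((γ+1)/2) h^{(γ+1)/(2(γ-1))}
        (α̃ + (mu[(γ-1)u - 2h]/((γ+1)rc₂)) h^{(γ-3)/(2(γ-1))})`. -/
theorem d1_c2_equation
    (γ : ℝ) (hγ : 1 < γ) (m : ℕ) (hm : 1 ≤ m)
    (U : Set (ℝ × ℝ)) (hU : IsOpen U) (hUr : ∀ p ∈ U, 0 < p.1)
    (h u : ℝ × ℝ → ℝ) (hhpos : ∀ p ∈ U, 0 < h p)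
    (hc : ∀ p ∈ U, (u p - h p) * (u p + h p) ≠ 0)
    (hhC : ContDiffOn ℝ 1 h U) (huC : ContDiffOn ℝ 1 u U)
    (heuler : IsEulerSound γ m U h u) :
    ∀ p ∈ U,
      Dc (fun q => u q - h q) (fun q => u q + h q) p
        = -((γ + 1) / 2) * h p ^ ((γ + 1) / (2 * (γ - 1)))
            * (alpT γ m h u p
              + (m : ℝ) * u p * ((γ - 1) * u p - 2 * h p)
                  / ((γ + 1) * p.1 * (u p + h p))
                * h p ^ ((γ - 3) / (2 * (γ - 1)))) := by
  intro p hp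
  have hr : p.1 ≠ 0 := (hUr p hp).ne'
  have hh := hhpos p hp
  have hc2 : u p + h p ≠ 0 := right_ne_zero_of_mul (hc p hp)
  have hg : γ - 1 ≠ 0 := by linarith
  have hg1 : γ + 1 ≠ 0 := by linarith
  have hhd : DifferentiableAt ℝ h p :=
    (hhC.differentiableOn (by norm_num)).differentiableAt (hU.mem_nhds hp)
  have hud : DifferentiableAt ℝ u p :=
    (huC.differentiableOn (by norm_num)).differentiableAt (hU.mem_nhds hp)
  have hfd : fderiv ℝ (fun q => u q + h q) p = fderiv ℝ u p + fderiv ℝ h p :=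
    fderiv_fun_add hud hhd
  have hpt : pdt (fun q => u q + h q) p = pdt u p + pdt h p := by
    simp [pdt, hfd]
  have hpr : pdr (fun q => u q + h q) p = pdr u p + pdr h p := by
    simp [pdr, hfd]
  have hpow : h p ^ ((γ + 1) / (2 * (γ - 1))) * h p ^ ((γ - 3) / (2 * (γ - 1))) = h p := by
    rw [← Real.rpow_add hh]
    have : (γ + 1) / (2 * (γ - 1)) + (γ - 3) / (2 * (γ - 1)) = 1 := by
      field_simp
      ring
    rw [this, Real.rpow_one]
  obtain ⟨e1, e2⟩ := heuler p hp
  have key : -((γ + 1) / 2) * h p ^ ((γ + 1) / (2 * (γ - 1)))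
            * (alpT γ m h u p
              + (m : ℝ) * u p * ((γ - 1) * u p - 2 * h p)
                  / ((γ + 1) * p.1 * (u p + h p))
                * h p ^ ((γ - 3) / (2 * (γ - 1))))
      = -((γ + 1) / 2) * (h p ^ ((γ + 1) / (2 * (γ - 1))) * h p ^ ((γ - 3) / (2 * (γ - 1))))
            * (alp γ m h u p
              + (m : ℝ) * u p * ((γ - 1) * u p - 2 * h p)
                  / ((γ + 1) * p.1 * (u p + h p))) := by
    unfold alpT
    ring
  rw [key, hpow]
  have ht : pdt h p = -((γ - 1) / 2) * ((m : ℝ) * u p * h p / p.1)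
      - u p * pdr h p - (γ - 1) / 2 * h p * pdr u p := by linarith
  have hut : pdt u p = - u p * pdr u p - 2 / (γ - 1) * h p * pdr h p := by linarith
  unfold Dc alp
  rw [hpt, hpr, ht, hut]
  field_simp
  ring
end
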